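/- arXiv:0811.1097 — 2 statements merged into one kernel-verified Lean document; each statement's English description precedes it below -/
import Mathlib

section
/- Let p : ℤ → Λ₃ be a stationary ergodic random field (i.e. p is distributed according to a probability measure on Λ₃^ℤ invariant and ergodic for the shift). For each n, let K = K^{(n)} be the random n×n birth-and-death kernel with rows (c_i, a_i, b_i) given by p(i) for 2 ≤ i ≤ n−1, by p(1)_+ for i = 1, and by p(n)_− for i = n. Then there exists a non-random probability measure μ on [−1,+1] such that almost surely W_p(μ_K, μ) → 0 as n → ∞ for every p ≥ 1, where μ_K = (1/n)Σ_{k=1}^n δ_{λ_k(K)} is the empirical spectral distribution of K. Moreover, for every integer ℓ ≥ 0, ∫ x^ℓ dμ(x) = E[r_ℓ^p(0)], where r_ℓ^p(0) is the probability of return to 0 in ℓ steps for the random walk on ℤ with environment p (transition probabilities q(i,i−1) = p(i)_1, q(i,i) = p(i)_2, q(i,i+1) = p(i)_3), the expectation being over the environment. -/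
open MeasureTheory ProbabilityTheory Filter Polynomial Topology

/-- The shift on environments `x : ℤ → ℝ³`. -/
def envShift (x : ℤ → ℝ × ℝ × ℝ) : ℤ → ℝ × ℝ × ℝ := fun i => x (i + 1)

/-- The simplex `Λ₃ = {v ∈ [0,1]³ : v₁+v₂+v₃ = 1}` (here a triple `(c,a,b)`). -/
def memSimplex (v : ℝ × ℝ × ℝ) : Prop :=
  v.1 ∈ Set.Icc (0:ℝ) 1 ∧ v.2.1 ∈ Set.Icc (0:ℝ) 1 ∧ v.2.2 ∈ Set.Icc (0:ℝ) 1 ∧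
    v.1 + v.2.1 + v.2.2 = 1

/-- The rows `(c_i, a_i, b_i)` of the birth-and-death kernel on `{1,…,n}` built from the
environment `x` (the row indexed by `j : Fin n` is the paper's row `i = j+1`): row `1` is
the reflection `p(1)_+ = (0, a, c+b)`, row `n` is `p(n)_− = (c+b, a, 0)`, and row `i` is
`p(i)` for `2 ≤ i ≤ n−1`. -/
noncomputable def envRow (x : ℤ → ℝ × ℝ × ℝ) (n : ℕ) (j : Fin n) : ℝ × ℝ × ℝ :=
  if (j : ℕ) = 0 then (0, (x 1).2.1, (x 1).1 + (x 1).2.2)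
  else if (j : ℕ) = n - 1 then ((x n).1 + (x n).2.2, (x n).2.1, 0)
  else ((x ((j : ℕ) + 1)).1, (x ((j : ℕ) + 1)).2.1, (x ((j : ℕ) + 1)).2.2)

/-- The tridiagonal (birth-and-death) matrix with rows `(c_i, a_i, b_i)`:
`K_{i,i+1} = b_i`, `K_{i,i} = a_i`, `K_{i,i−1} = c_i`. -/
def Kbd (n : ℕ) (row : Fin n → ℝ × ℝ × ℝ) : Matrix (Fin n) (Fin n) ℝ := fun i j =>
  if (j : ℕ) = (i : ℕ) + 1 then (row i).2.2
  else if j = i then (row i).2.1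
  else if (i : ℕ) = (j : ℕ) + 1 then (row i).1
  else 0

/-- `retProb x ℓ i` is the probability that the random walk on `ℤ` in the environment `x`
(stepping `i → i−1` with prob. `c = x(i)₁`, staying with prob. `a = x(i)₂`, and `i → i+1`
with prob. `b = x(i)₃`) started at `i` is at `0` after `ℓ` steps; `retProb x ℓ 0 = r_ℓ(0)`. -/
noncomputable def retProb (x : ℤ → ℝ × ℝ × ℝ) : ℕ → ℤ → ℝ
  | 0, i => if i = 0 then 1 else 0
  | (ℓ+1), i =>
      (x i).1 * retProb x ℓ (i-1) + (x i).2.1 * retProb x ℓ i +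
        (x i).2.2 * retProb x ℓ (i+1)

/-- Empirical measure of a finite family of reals: `(1/n) ∑_k δ_{v_k}`. -/
noncomputable def empMeasure (n : ℕ) (v : Fin n → ℝ) : Measure ℝ :=
  ((n : ENNReal))⁻¹ • ∑ k : Fin n, Measure.dirac (v k)

/-- The Wasserstein distance of order `p` between two measures on `ℝ`. -/
noncomputable def Wdist (p : ℝ) (μ ν : Measure ℝ) : ENNReal :=
  ⨅ (π : Measure (ℝ × ℝ)) (_ : π.map Prod.fst = μ) (_ : π.map Prod.snd = ν),
    (∫⁻ q, ENNReal.ofReal (|q.1 - q.2| ^ p) ∂π) ^ (1/p)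



section birk
variable {Ω : Type*} [MeasurableSpace Ω] {μ : Measure Ω} [IsProbabilityMeasure μ] {T : Ω → Ω}

/-- Running maximum of Birkhoff sums. -/
noncomputable def bmax (T : Ω → Ω) (f : Ω → ℝ) : ℕ → Ω → ℝ
  | 0, _ => 0
  | (n+1), x => max (bmax T f n x) (birkhoffSum T f (n+1) x)

lemma le_bmax (f : Ω → ℝ) (n : ℕ) (x : Ω) : ∀ k ≤ n, birkhoffSum T f k x ≤ bmax T f n x := by
  induction n with
  | zero => intro k hk; obtain rfl : k = 0 := by omega
            simp [bmax]
  | succ n ih =>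
    intro k hk
    rcases Nat.lt_or_ge n k with h | h
    · obtain rfl : k = n+1 := by omega
      exact le_max_right _ _
    · exact (ih k h).trans (le_max_left _ _)

lemma bmax_eq (f : Ω → ℝ) (n : ℕ) (x : Ω) : ∃ k ≤ n, bmax T f n x = birkhoffSum T f k x := by
  induction n with
  | zero => exact ⟨0, le_rfl, by simp [bmax]⟩
  | succ n ih =>
    obtain ⟨k, hk, h⟩ := ih
    rcases le_total (bmax T f n x) (birkhoffSum T f (n+1) x) with h' | h'
    · exact ⟨n+1, le_rfl, by simp [bmax, h']⟩
    · exact ⟨k, by omega, by simp [bmax, h', ← h]⟩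

lemma bmax_nonneg (f : Ω → ℝ) (n : ℕ) (x : Ω) : 0 ≤ bmax T f n x := by
  simpa using le_bmax (T := T) f n x 0 (Nat.zero_le _)

lemma measurable_bsum (hT : Measurable T) {f : Ω → ℝ} (hf : Measurable f) (n : ℕ) :
    Measurable (birkhoffSum T f n) := by
  unfold birkhoffSum
  exact Finset.measurable_fun_sum _ fun k _ => hf.comp (hT.iterate k)

lemma measurable_bmax (hT : Measurable T) {f : Ω → ℝ} (hf : Measurable f) (n : ℕ) :
    Measurable (bmax T f n) := by
  induction n with
  | zero => exact measurable_const
  | succ n ih => exact ih.max (measurable_bsum hT hf (n+1))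

lemma integrable_bsum (hT : MeasurePreserving T μ μ) {f : Ω → ℝ} (hf : Integrable f μ) (n : ℕ) :
    Integrable (birkhoffSum T f n) μ := by
  unfold birkhoffSum
  exact integrable_finsetSum _ fun k _ => (hT.iterate k).integrable_comp_of_integrable hf

lemma integrable_bmax (hT : MeasurePreserving T μ μ) {f : Ω → ℝ} (hf : Integrable f μ) (n : ℕ) :
    Integrable (bmax T f n) μ := by
  induction n with
  | zero => exact integrable_const _
  | succ n ih => exact ih.sup (integrable_bsum hT hf (n+1))

lemma maximal_ergodic (hT : MeasurePreserving T μ μ) {f : Ω → ℝ} (hfm : Measurable f)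
    (hf : Integrable f μ) (n : ℕ) : 0 ≤ ∫ x in {x | 0 < bmax T f n x}, f x ∂μ := by
  set A := {x | 0 < bmax T f n x}
  have hA : MeasurableSet A := measurableSet_lt measurable_const (measurable_bmax hT.measurable hfm n)
  have hM := integrable_bmax hT hf n
  have hMT : Integrable (fun x => bmax T f n (T x)) μ := hT.integrable_comp_of_integrable hM
  have h1 : ∫ x in A, (bmax T f n x - bmax T f n (T x)) ∂μ ≤ ∫ x in A, f x ∂μ := by
    refine setIntegral_mono_on (hM.sub hMT).integrableOn hf.integrableOn hA ?_
    intro x hx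
    obtain ⟨k, hk, h⟩ := bmax_eq (T := T) f n x
    have hx' : 0 < bmax T f n x := hx
    rcases k with _ | k
    · simp [h] at hx'
    · rw [h, birkhoffSum_succ']
      have := le_bmax (T := T) f n (T x) k (by omega)
      linarith
  have h2 : ∫ x, (bmax T f n x - bmax T f n (T x)) ∂μ = 0 := by
    rw [integral_sub hM hMT, sub_eq_zero]
    have := integral_map (μ := μ) hT.measurable.aemeasurable (f := bmax T f n)
      (measurable_bmax hT.measurable hfm n).aestronglyMeasurable
    rw [hT.map_eq] at this
    exact this
  have h3 : ∫ x, (bmax T f n x - bmax T f n (T x)) ∂μ ≤ ∫ x in A, (bmax T f n x - bmax T f n (T x)) ∂μ := by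
    rw [← integral_indicator hA]
    refine integral_mono (hM.sub hMT) ((hM.sub hMT).indicator hA) ?_
    intro x
    by_cases hx : x ∈ A
    · simp [hx]
    · simp only [Set.indicator_of_notMem hx]
      have : ¬ 0 < bmax T f n x := hx
      have := bmax_nonneg (T := T) f n (T x)
      linarith
  linarith

lemma birk_bdd (hT : Ergodic T μ) {f : Ω → ℝ} (hfm : Measurable f)
    (hf : Integrable f μ) (hneg : ∫ x, f x ∂μ < 0) :
    ∀ᵐ x ∂μ, BddAbove (Set.range fun n => birkhoffSum T f n x) := by
  have hTm : Measurable T := hT.toMeasurePreserving.measurable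
  set B := {x | BddAbove (Set.range fun n => birkhoffSum T f n x)}
  have hB : MeasurableSet B := measurableSet_bddAbove_range (fun n => measurable_bsum hTm hfm n)
  have hinv : T ⁻¹' B = B := by
    ext x
    simp only [B, Set.mem_preimage, Set.mem_setOf_eq]
    constructor
    · rintro ⟨C, hC⟩
      refine ⟨max 0 (f x + C), ?_⟩
      rintro _ ⟨n, rfl⟩
      rcases n with _ | n
      · simp
      · simp only [birkhoffSum_succ']
        have : birkhoffSum T f n (T x) ≤ C := hC ⟨n, rfl⟩
        exact le_max_of_le_right (by linarith)
    · rintro ⟨C, hC⟩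
      refine ⟨C - f x, ?_⟩
      rintro _ ⟨n, rfl⟩
      have : birkhoffSum T f (n+1) x ≤ C := hC ⟨n+1, rfl⟩
      rw [birkhoffSum_succ'] at this
      simp only
      linarith
  have key := hT.toPreErgodic.aeconst_set hB hinv
  rw [eventuallyConst_set'] at key
  rcases key with h | h
  · exfalso
    have hae : ∀ᵐ x ∂μ, x ∉ B := by
      filter_upwards [h] with x hx hxB
      have : (x ∈ B) = (x ∈ (∅ : Set Ω)) := hx
      simp [hxB] at this
    have hlim : Tendsto (fun n => ∫ x, Set.indicator {x | 0 < bmax T f n x} f x ∂μ) atTop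
        (𝓝 (∫ x, f x ∂μ)) := by
      refine tendsto_integral_of_dominated_convergence (fun x => |f x|) ?_ hf.abs ?_ ?_
      · intro n
        exact (hfm.indicator (measurableSet_lt measurable_const
          (measurable_bmax hTm hfm n))).aestronglyMeasurable
      · intro n
        exact Eventually.of_forall fun x => norm_indicator_le_norm_self f x
      · filter_upwards [hae] with x hx
        have : ∃ n, 0 < birkhoffSum T f n x := by
          by_contra! hc
          exact hx ⟨0, by rintro _ ⟨n, rfl⟩; exact hc n⟩
        obtain ⟨n, hn⟩ := this
        refine tendsto_const_nhds.congr' ?_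
        filter_upwards [eventually_ge_atTop n] with m hm
        rw [Set.indicator_of_mem]
        exact hn.trans_le (le_bmax (T := T) f m x n hm)
    have : 0 ≤ ∫ x, f x ∂μ := by
      refine ge_of_tendsto' hlim fun n => ?_
      rw [integral_indicator (measurableSet_lt measurable_const (measurable_bmax hTm hfm n))]
      exact maximal_ergodic hT.toMeasurePreserving hfm hf n
    linarith
  · filter_upwards [h] with x hx
    have : (x ∈ B) = (x ∈ (Set.univ : Set Ω)) := hx
    simpa [B] using this

lemma birk_upper (hT : Ergodic T μ) {f : Ω → ℝ} (hfm : Measurable f)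
    (hf : Integrable f μ) :
    ∀ᵐ x ∂μ, ∀ a, ∫ x, f x ∂μ < a → ∀ᶠ n : ℕ in atTop, birkhoffSum T f n x / n < a := by
  have h : ∀ k : ℕ, ∀ᵐ x ∂μ,
      BddAbove (Set.range fun n => birkhoffSum T (fun x => f x - (∫ x, f x ∂μ + 1 / (k+1))) n x) := by
    intro k
    refine birk_bdd hT (hfm.sub_const _) (hf.sub (integrable_const _)) ?_
    rw [integral_sub hf (integrable_const _)]
    simp
    positivity
  filter_upwards [ae_all_iff.2 h] with x hx a ha
  obtain ⟨k, hk⟩ := exists_nat_one_div_lt (sub_pos.2 ha)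
  obtain ⟨C, hC⟩ := hx k
  set c := ∫ x, f x ∂μ + 1 / ((k:ℝ)+1)
  have hca : 0 < a - c := by simp only [c]; linarith
  obtain ⟨N, hN⟩ := exists_nat_gt (C / (a - c))
  filter_upwards [eventually_gt_atTop N] with n hn
  have h1 : birkhoffSum T (fun x => f x - c) n x ≤ C := hC ⟨n, rfl⟩
  have h2 : birkhoffSum T (fun x => f x - c) n x = birkhoffSum T f n x - n * c := by
    simp [birkhoffSum]
  have hn0 : (0:ℝ) < n := by exact_mod_cast (by omega : 0 < n)
  have hNn : (N:ℝ) < n := by exact_mod_cast hn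
  rw [div_lt_iff₀ hn0]
  have : C < (a - c) * n := by
    have := (div_lt_iff₀ hca).1 (hN.trans hNn)
    linarith
  nlinarith

theorem birkhoff_ergodic (hT : Ergodic T μ) {f : Ω → ℝ} (hfm : Measurable f)
    (hf : Integrable f μ) :
    ∀ᵐ x ∂μ, Tendsto (fun n : ℕ => birkhoffSum T f n x / n) atTop (𝓝 (∫ x, f x ∂μ)) := by
  filter_upwards [birk_upper hT hfm hf, birk_upper hT hfm.neg hf.neg] with x h1 h2
  rw [tendsto_order]
  refine ⟨fun a ha => ?_, h1⟩
  have := h2 (-a) (by simp only [Pi.neg_apply, integral_neg]; linarith)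
  filter_upwards [this] with n hn
  have : birkhoffSum T (-f) n x = - birkhoffSum T f n x := by simp [birkhoffSum]
  rw [this, neg_div] at hn
  linarith
end birk

section tr
lemma det_aeval_of_charpoly {n : ℕ} (M : Matrix (Fin n) (Fin n) ℂ) (l : Fin n → ℂ)
    (h : M.charpoly = ∏ k, (X - C (l k))) (q : ℂ[X]) :
    (aeval M q).det = ∏ k, q.eval (l k) := by
  have hs : q.Splits := IsAlgClosed.splits q
  rw [hs.eq_prod_roots]
  generalize q.roots = s
  generalize q.leadingCoeff = c
  rw [map_mul, aeval_C, Matrix.det_mul, Matrix.algebraMap_eq_diagonal, Matrix.det_diagonal]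
  simp only [eval_mul, eval_C, Finset.prod_mul_distrib, Pi.algebraMap_apply, Algebra.algebraMap_self,
    RingHom.id_apply]
  congr 1
  induction s using Multiset.induction_on with
  | empty => simp
  | cons a s ih =>
    simp only [Multiset.map_cons, Multiset.prod_cons, map_mul, Matrix.det_mul, eval_mul,
      Finset.prod_mul_distrib, ih]
    congr 1
    have h2 : M.charpoly.eval a = ∏ k, (a - l k) := by
      rw [h, eval_prod]; simp
    rw [Matrix.eval_charpoly] at h2
    have h3 : (aeval M (X - C a)) = -(Matrix.scalar (Fin n) a - M) := by
      simp [Matrix.algebraMap_eq_diagonal, Matrix.scalar_apply]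
    rw [h3, Matrix.det_neg, h2]
    simp only [eval_sub, eval_X, eval_C]
    have : ∀ k, l k - a = (-1) * (a - l k) := fun k => by ring
    simp_rw [this, Finset.prod_mul_distrib]
    simp

lemma trace_pow_complex {n : ℕ} (M : Matrix (Fin n) (Fin n) ℂ) (l : Fin n → ℂ)
    (h : M.charpoly = ∏ k, (X - C (l k))) (m : ℕ) :
    (M ^ m).trace = ∑ k, l k ^ m := by
  have h1 : (M ^ m).charpoly = ∏ k, (X - C (l k ^ m)) := by
    apply Polynomial.funext
    intro t
    rw [Matrix.eval_charpoly, eval_prod]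
    have := det_aeval_of_charpoly M l h (C t - X ^ m)
    simp only [map_sub, aeval_C, map_pow, aeval_X, eval_sub, eval_C, eval_pow, eval_X] at this ⊢
    rw [← this]
    rfl
  rw [Matrix.trace_eq_sum_roots_charpoly, h1, Finset.prod_eq_multiset_prod]
  have := roots_multiset_prod_X_sub_C ((Finset.univ : Finset (Fin n)).val.map (fun k => l k ^ m))
  rw [Multiset.map_map] at this
  exact congrArg Multiset.sum this

lemma trace_pow_real {n : ℕ} (M : Matrix (Fin n) (Fin n) ℝ) (l : Fin n → ℝ)
    (h : M.charpoly = ∏ k, (X - C (l k))) (m : ℕ) :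
    (M ^ m).trace = ∑ k, l k ^ m := by
  have h1 := trace_pow_complex (M.map (algebraMap ℝ ℂ)) (fun k => (l k : ℂ)) (by
    rw [Matrix.charpoly_map, h, Polynomial.map_prod]; simp) m
  rw [← Matrix.map_pow] at h1
  have h2 : ((M^m).map (algebraMap ℝ ℂ)).trace = (((M^m).trace : ℝ) : ℂ) := by
    simp [Matrix.trace]
  rw [h2] at h1
  exact_mod_cast h1
end tr

section mom
abbrev II : Type := Set.Icc (-1:ℝ) 1

lemma integral_poly_of_moments (P : ProbabilityMeasure II) (q : ℝ[X]) :
    ∫ t, q.eval (t:ℝ) ∂(P : Measure II) = q.sum (fun l a => a * ∫ t : II, (t:ℝ)^l ∂(P : Measure II)) := by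
  simp only [Polynomial.eval_eq_sum, Polynomial.sum_def]
  rw [integral_finsetSum]
  · simp_rw [integral_const_mul]
  · intro i _
    apply Integrable.const_mul
    have hc : Continuous (fun t : II => (t:ℝ)^i) := by fun_prop
    exact hc.integrable_of_hasCompactSupport (HasCompactSupport.of_compactSpace _)

lemma moments_ext (P Q : ProbabilityMeasure II)
    (h : ∀ l : ℕ, ∫ t : II, (t:ℝ)^l ∂(P : Measure II) = ∫ t : II, (t:ℝ)^l ∂(Q : Measure II)) : P = Q := by
  apply Subtype.ext
  have iP : IsProbabilityMeasure (P : Measure II) := P.2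
  have iQ : IsProbabilityMeasure (Q : Measure II) := Q.2
  refine ext_of_forall_integral_eq_of_IsFiniteMeasure (μ := (P : Measure II)) (ν := (Q : Measure II)) fun f => ?_
  have hInt : ∀ R : ProbabilityMeasure II, ∀ g : II → ℝ, Continuous g → Integrable g (R : Measure II) :=
    fun R g hc => hc.integrable_of_hasCompactSupport (HasCompactSupport.of_compactSpace _)
  refine eq_of_forall_dist_le fun ε hε => ?_
  obtain ⟨q, hq⟩ := exists_polynomial_near_continuousMap (-1) 1 f.toContinuousMap (ε/2) (by positivity)
  have hq' : ∀ t : II, |q.eval (t:ℝ) - f t| ≤ ε/2 := fun t => by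
    have := (ContinuousMap.norm_coe_le_norm (q.toContinuousMapOn _ - f.toContinuousMap) t).trans hq.le
    simpa using this
  have hb : ∀ R : ProbabilityMeasure II,
      |∫ t, q.eval (t:ℝ) ∂(R : Measure II) - ∫ t, f t ∂(R : Measure II)| ≤ ε/2 := by
    intro R
    rw [← integral_sub (hInt R _ (by fun_prop)) (hInt R _ f.continuous)]
    have := norm_integral_le_of_norm_le_const (μ := (R : Measure II)) (f := fun t : II => q.eval (t:ℝ) - f t)
      (Eventually.of_forall fun t => by simpa using hq' t)
    simpa using this
  have h1 := hb P
  have h2 := hb Q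
  have h3 : ∫ t, q.eval (t:ℝ) ∂(P : Measure II) = ∫ t, q.eval (t:ℝ) ∂(Q : Measure II) := by
    rw [integral_poly_of_moments, integral_poly_of_moments]; simp_rw [h]
  rw [h3] at h1
  rw [Real.dist_eq]
  rw [abs_le] at *
  constructor <;> linarith [h1.1, h1.2, h2.1, h2.2]

lemma tendsto_moment {L : Filter ℕ} {P : ℕ → ProbabilityMeasure II} {Q : ProbabilityMeasure II}
    (h : Tendsto P L (𝓝 Q)) (l : ℕ) : Tendsto (fun n => ∫ t : II, (t:ℝ)^l ∂(P n : Measure II)) L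
      (𝓝 (∫ t : II, (t:ℝ)^l ∂(Q : Measure II))) := by
  have := (ProbabilityMeasure.tendsto_iff_forall_integral_tendsto.1 h)
    (BoundedContinuousFunction.mkOfCompact ⟨fun t : II => (t:ℝ)^l, by fun_prop⟩)
  simpa using this

lemma moments_exists {P : ℕ → ProbabilityMeasure II} {m : ℕ → ℝ}
    (h : ∀ l : ℕ, Tendsto (fun n => ∫ t : II, (t:ℝ)^l ∂(P n : Measure II)) atTop (𝓝 (m l))) :
    ∃ Q : ProbabilityMeasure II, ∀ l : ℕ, ∫ t : II, (t:ℝ)^l ∂(Q : Measure II) = m l := by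
  let U : Ultrafilter ℕ := hyperfilter ℕ
  have hU : (U : Filter ℕ) ≤ atTop := by
    rw [← Nat.cofinite_eq_atTop]; exact hyperfilter_le_cofinite
  refine ⟨(U.map P).lim, fun l => ?_⟩
  have h1 : Tendsto P U (𝓝 (U.map P).lim) := (U.map P).le_nhds_lim
  exact tendsto_nhds_unique (tendsto_moment h1 l) ((h l).mono_left hU)

lemma moments_tendsto {P : ℕ → ProbabilityMeasure II} {Q : ProbabilityMeasure II}
    (h : ∀ l : ℕ, Tendsto (fun n => ∫ t : II, (t:ℝ)^l ∂(P n : Measure II)) atTop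
      (𝓝 (∫ t : II, (t:ℝ)^l ∂(Q : Measure II)))) : Tendsto P atTop (𝓝 Q) := by
  rw [tendsto_iff_ultrafilter]
  intro U hU
  have h1 : Tendsto P U (𝓝 (U.map P).lim) := (U.map P).le_nhds_lim
  have : (U.map P).lim = Q := by
    apply moments_ext
    intro l
    exact tendsto_nhds_unique (tendsto_moment h1 l) ((h l).mono_left hU)
  rwa [this] at h1
end mom
section quant
/-- Quantile function. -/
noncomputable def qf (μ : Measure ℝ) (u : ℝ) : ℝ := sInf {t | u ≤ cdf μ t}

variable {μ : Measure ℝ} [IsProbabilityMeasure μ]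

lemma cdf_lt_neg_one (h : μ (Set.Icc (-1) 1)ᶜ = 0) {t : ℝ} (ht : t < -1) : cdf μ t = 0 := by
  rw [cdf_eq_real, measureReal_def, measure_mono_null _ h]; · rfl
  intro s hs hs'
  exact absurd (hs'.1.trans hs) (not_le.2 ht)

lemma cdf_one (h : μ (Set.Icc (-1) 1)ᶜ = 0) : cdf μ 1 = 1 := by
  rw [cdf_eq_real, measureReal_def, (prob_compl_eq_zero_iff measurableSet_Iic).1 (measure_mono_null _ h)]
  · rfl
  intro s hs hs'
  exact hs hs'.2

lemma qf_bdd (h : μ (Set.Icc (-1) 1)ᶜ = 0) {u : ℝ} (h0 : 0 < u) :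
    ∀ t ∈ {t | u ≤ cdf μ t}, -1 ≤ t := by
  intro t ht
  by_contra! hc
  have ht' : u ≤ cdf μ t := ht
  rw [cdf_lt_neg_one h hc] at ht'
  linarith

lemma qf_le_iff (h : μ (Set.Icc (-1) 1)ᶜ = 0) {u : ℝ} (h0 : 0 < u) (h1 : u ≤ 1) (t : ℝ) :
    qf μ u ≤ t ↔ u ≤ cdf μ t := by
  have hne : {t | u ≤ cdf μ t}.Nonempty := ⟨1, by simpa [cdf_one h] using h1⟩
  have hbd : BddBelow {t | u ≤ cdf μ t} := ⟨-1, qf_bdd h h0⟩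
  constructor
  · intro hq
    have hev : ∀ s, t < s → u ≤ cdf μ s := by
      intro s hs
      obtain ⟨r, hr, hrs⟩ := exists_lt_of_csInf_lt hne (lt_of_le_of_lt hq hs)
      exact le_trans hr (monotone_cdf μ hrs.le)
    have hr : Tendsto (cdf μ) (𝓝[>] t) (𝓝 (cdf μ t)) :=
      ((cdf μ).right_continuous t).tendsto.mono_left (nhdsWithin_mono _ Set.Ioi_subset_Ici_self)
    refine ge_of_tendsto hr ?_
    filter_upwards [self_mem_nhdsWithin] with s hs using hev s hs
  · intro hu
    exact csInf_le hbd hu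

lemma qf_mem (h : μ (Set.Icc (-1) 1)ᶜ = 0) {u : ℝ} (h0 : 0 < u) (h1 : u ≤ 1) :
    qf μ u ∈ Set.Icc (-1:ℝ) 1 := by
  refine ⟨?_, (qf_le_iff h h0 h1 1).2 (by simpa [cdf_one h] using h1)⟩
  exact qf_bdd h h0 _ ((qf_le_iff h h0 h1 _).1 le_rfl)

lemma qf_mono (h : μ (Set.Icc (-1) 1)ᶜ = 0) : MonotoneOn (qf μ) (Set.Ioo 0 1) := by
  intro u hu v hv huv
  rw [qf_le_iff h hu.1 hu.2.le]
  exact huv.trans ((qf_le_iff h hv.1 hv.2.le _).1 le_rfl)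

lemma qf_aemeas (h : μ (Set.Icc (-1) 1)ᶜ = 0) :
    AEMeasurable (qf μ) (volume.restrict (Set.Ioo (0:ℝ) 1)) :=
  aemeasurable_restrict_of_monotoneOn measurableSet_Ioo (qf_mono h)

lemma qf_map (h : μ (Set.Icc (-1) 1)ᶜ = 0) :
    (volume.restrict (Set.Ioo (0:ℝ) 1)).map (qf μ) = μ := by
  have : IsProbabilityMeasure (volume.restrict (Set.Ioo (0:ℝ) 1)) := ⟨by simp⟩
  have : IsProbabilityMeasure ((volume.restrict (Set.Ioo (0:ℝ) 1)).map (qf μ)) :=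
    Measure.isProbabilityMeasure_map (qf_aemeas h)
  refine Measure.ext_of_Iic _ _ fun t => ?_
  rw [Measure.map_apply_of_aemeasurable (qf_aemeas h) measurableSet_Iic, ← ofReal_cdf]
  have hset : (volume.restrict (Set.Ioo (0:ℝ) 1)) (qf μ ⁻¹' Set.Iic t) =
      (volume.restrict (Set.Ioo (0:ℝ) 1)) (Set.Iic (cdf μ t)) := by
    apply measure_congr
    filter_upwards [ae_restrict_mem measurableSet_Ioo] with u hu
    apply propext
    exact qf_le_iff h hu.1 hu.2.le t
  rw [hset, Measure.restrict_apply measurableSet_Iic]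
  have hc0 := cdf_nonneg μ t
  have hc1 := cdf_le_one μ t
  apply le_antisymm
  · calc _ ≤ volume (Set.Ioc 0 (cdf μ t)) := measure_mono fun u hu => ⟨hu.2.1, hu.1⟩
      _ = _ := by simp
  · calc ENNReal.ofReal (cdf μ t) = volume (Set.Ioo 0 (cdf μ t)) := by simp
      _ ≤ volume (Set.Iic (cdf μ t) ∩ Set.Ioo 0 1) :=
        measure_mono fun u hu => ⟨hu.2.le, hu.1, hu.2.trans_le hc1⟩

lemma qf_tendsto {μs : ℕ → Measure ℝ} [∀ n, IsProbabilityMeasure (μs n)]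
    (h : μ (Set.Icc (-1) 1)ᶜ = 0) (hs : ∀ n, μs n (Set.Icc (-1) 1)ᶜ = 0)
    (hlim : ∀ t, μ {t} = 0 → Tendsto (fun n => cdf (μs n) t) atTop (𝓝 (cdf μ t))) :
    ∀ᵐ u ∂(volume.restrict (Set.Ioo (0:ℝ) 1)), Tendsto (fun n => qf (μs n) u) atTop (𝓝 (qf μ u)) := by
  have hcount := (qf_mono h).countable_not_continuousWithinAt
  have hdense : ∀ a b : ℝ, a < b → ∃ t, μ {t} = 0 ∧ a < t ∧ t < b := by
    intro a b hab
    have hc : {t : ℝ | 0 < μ {t}}.Countable :=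
      Measure.countable_meas_pos_of_disjoint_iUnion (μ := μ) (fun t => measurableSet_singleton t)
        (fun i j hij => by simpa using hij)
    obtain ⟨t, ht, h1, h2⟩ := (hc.dense_compl ℝ).exists_between hab
    exact ⟨t, by simpa using ht, h1, h2⟩
  filter_upwards [ae_restrict_mem measurableSet_Ioo, ae_restrict_of_ae (hcount.ae_notMem volume)] with u hu hu2
  have hcont : ContinuousWithinAt (qf μ) (Set.Ioo 0 1) u := by
    by_contra hc
    exact hu2 ⟨hu, hc⟩
  rw [tendsto_order]
  constructor
  · intro a ha
    obtain ⟨t, ht, h1, h2⟩ := hdense _ _ ha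
    have : cdf μ t < u := by
      rw [← not_le, ← qf_le_iff h hu.1 hu.2.le]; exact not_le.2 h2
    filter_upwards [(hlim t ht).eventually_lt_const this] with n hn
    rw [← not_le, ← qf_le_iff (hs n) hu.1 hu.2.le, not_le] at hn
    exact h1.trans hn
  · intro b hb
    obtain ⟨t, ht, h1, h2⟩ := hdense _ _ hb
    have hex : ∃ v ∈ Set.Ioo (0:ℝ) 1, u < v ∧ qf μ v < t := by
      have hc2 : ContinuousAt (qf μ) u := hcont.continuousAt (Ioo_mem_nhds hu.1 hu.2)
      have e1 : ∀ᶠ v in 𝓝[>] u, qf μ v < t := (hc2.eventually_lt_const h1).filter_mono nhdsWithin_le_nhds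
      have e2 : ∀ᶠ v in 𝓝[>] u, v ∈ Set.Ioo u 1 := Ioo_mem_nhdsGT hu.2
      obtain ⟨v, hv1, hv2⟩ := (e1.and e2).exists
      exact ⟨v, ⟨hu.1.trans hv2.1, hv2.2⟩, hv2.1, hv1⟩
    obtain ⟨v, hv, huv, hvt⟩ := hex
    have : u < cdf μ t := huv.trans_le ((qf_le_iff h hv.1 hv.2.le t).1 hvt.le)
    filter_upwards [(hlim t ht).eventually_const_lt this] with n hn
    exact ((qf_le_iff (hs n) hu.1 hu.2.le t).2 hn.le).trans_lt h2

lemma Wdist_tendsto {μs : ℕ → Measure ℝ} [∀ n, IsProbabilityMeasure (μs n)]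
    (h : μ (Set.Icc (-1) 1)ᶜ = 0) (hs : ∀ n, μs n (Set.Icc (-1) 1)ᶜ = 0)
    (hlim : ∀ t, μ {t} = 0 → Tendsto (fun n => cdf (μs n) t) atTop (𝓝 (cdf μ t)))
    {p : ℝ} (hp : 1 ≤ p) :
    Tendsto (fun n => Wdist p (μs n) μ) atTop (𝓝 0) := by
  have hp0 : 0 < p := by linarith
  obtain ⟨V, hV⟩ : ∃ V, V = volume.restrict (Set.Ioo (0:ℝ) 1) := ⟨_, rfl⟩
  have hVp : IsProbabilityMeasure V := ⟨by simp [hV]⟩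
  have hpair : ∀ n, AEMeasurable (fun u => (qf (μs n) u, qf μ u)) V :=
    hV ▸ fun n => (qf_aemeas (hs n)).prodMk (qf_aemeas h)
  have hle : ∀ n, Wdist p (μs n) μ ≤
      (∫⁻ u, ENNReal.ofReal (|qf (μs n) u - qf μ u| ^ p) ∂V) ^ (1/p) := by
    intro n
    have hm : Measurable (fun q : ℝ × ℝ => ENNReal.ofReal (|q.1 - q.2| ^ p)) := by fun_prop
    refine (iInf₂_le_of_le (V.map (fun u => (qf (μs n) u, qf μ u))) ?_ (iInf_le_of_le ?_ ?_))
    · rw [AEMeasurable.map_map_of_aemeasurable measurable_fst.aemeasurable (hpair n)]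
      rw [hV]; exact qf_map (hs n)
    · rw [AEMeasurable.map_map_of_aemeasurable measurable_snd.aemeasurable (hpair n)]
      rw [hV]; exact qf_map h
    · rw [lintegral_map' hm.aemeasurable (hpair n)]
  have hInt : Tendsto (fun n => ∫⁻ u, ENNReal.ofReal (|qf (μs n) u - qf μ u| ^ p) ∂V) atTop (𝓝 0) := by
    have : (0 : ENNReal) = ∫⁻ u, 0 ∂V := by simp
    rw [this]
    refine tendsto_lintegral_of_dominated_convergence' (fun _ => ENNReal.ofReal (2 ^ p)) ?_ ?_ ?_ ?_
    · intro n
      have hm : Measurable (fun q : ℝ × ℝ => ENNReal.ofReal (|q.1 - q.2| ^ p)) := by fun_prop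
      have hcm := hm.comp_aemeasurable (hpair n)
      simp only [Function.comp_def] at hcm
      exact hcm
    · intro n
      rw [hV]; filter_upwards [ae_restrict_mem measurableSet_Ioo] with u hu
      apply ENNReal.ofReal_le_ofReal
      apply Real.rpow_le_rpow (abs_nonneg _) _ hp0.le
      have h1 := qf_mem (hs n) hu.1 hu.2.le
      have h2 := qf_mem h hu.1 hu.2.le
      rw [abs_le]; constructor <;> linarith [h1.1, h1.2, h2.1, h2.2]
    · simp
    · rw [hV]; filter_upwards [qf_tendsto h hs hlim] with u hu
      have h1 : Tendsto (fun n => |qf (μs n) u - qf μ u| ^ p) atTop (𝓝 (|qf μ u - qf μ u| ^ p)) :=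
        ((hu.sub_const _).abs).rpow_const (Or.inr hp0.le)
      have h2 := ENNReal.tendsto_ofReal h1
      simpa [Real.zero_rpow hp0.ne'] using h2
  have hfin : Tendsto (fun n => (∫⁻ u, ENNReal.ofReal (|qf (μs n) u - qf μ u| ^ p) ∂V) ^ (1/p)) atTop (𝓝 0) := by
    have h3 := (ENNReal.continuous_rpow_const (y := 1/p)).tendsto 0 |>.comp hInt
    rw [ENNReal.zero_rpow_of_pos (by positivity)] at h3
    exact h3
  exact tendsto_of_tendsto_of_tendsto_of_le_of_le tendsto_const_nhds hfin (fun _ => zero_le) hle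
end quant

section walk
lemma Kbd_sum (n : ℕ) (row : Fin n → ℝ × ℝ × ℝ) (i : Fin n) (w : ℤ → ℝ) :
    ∑ j : Fin n, Kbd n row i j * w (j : ℕ) =
      (if (i:ℕ) + 1 < n then (row i).2.2 * w ((i:ℕ) + 1) else 0) + (row i).2.1 * w (i:ℕ) +
      (if 0 < (i:ℕ) then (row i).1 * w ((i:ℕ) - 1) else 0) := by
  have h : ∀ j : Fin n, Kbd n row i j * w (j : ℕ) =
      (if (j:ℕ) = (i:ℕ) + 1 then (row i).2.2 * w ((i:ℕ)+1) else 0) +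
      (if j = i then (row i).2.1 * w (i:ℕ) else 0) +
      (if (i:ℕ) = (j:ℕ) + 1 then (row i).1 * w ((i:ℕ) - 1) else 0) := by
    intro j
    unfold Kbd
    by_cases h1 : (j:ℕ) = (i:ℕ) + 1
    · have h2 : j ≠ i := by rintro rfl; omega
      have h3 : ¬ (i:ℕ) = (j:ℕ) + 1 := by omega
      rw [if_pos h1, if_pos h1, if_neg h2, if_neg h3, h1]; push_cast; ring
    · by_cases h2 : j = i
      · subst h2; simp
      · by_cases h3 : (i:ℕ) = (j:ℕ) + 1
        · have e : ((j:ℕ):ℤ) = (i:ℕ) - 1 := by omega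
          rw [if_neg h1, if_neg h2, if_pos h3, if_neg h1, if_neg h2, if_pos h3, e]; ring
        · simp [h1, h2, h3]
  simp_rw [h, Finset.sum_add_distrib]
  congr 1
  · congr 1
    · split_ifs with hi
      · rw [Finset.sum_eq_single (⟨(i:ℕ)+1, hi⟩ : Fin n)]
        · simp
        · intro b _ hb
          rw [if_neg]
          intro h'; exact hb (Fin.ext h')
        · simp
      · apply Finset.sum_eq_zero
        intro j _
        rw [if_neg]; omega
    · simp
  · split_ifs with hi
    · rw [Finset.sum_eq_single (⟨(i:ℕ)-1, by omega⟩ : Fin n)]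
      · rw [if_pos]; simp; omega
      · intro b _ hb
        rw [if_neg]
        intro h'; exact hb (Fin.ext (by simp; omega))
      · simp
    · apply Finset.sum_eq_zero
      intro j _
      rw [if_neg]; omega

lemma Kbd_stoch {x : ℤ → ℝ × ℝ × ℝ} (hx : ∀ i, memSimplex (x i)) {n : ℕ} (hn : 2 ≤ n) :
    Kbd n (envRow x n) ∈ Matrix.rowStochastic ℝ (Fin n) := by
  rw [Matrix.mem_rowStochastic_iff_sum]
  constructor
  · intro i j
    have hrow : 0 ≤ (envRow x n i).1 ∧ 0 ≤ (envRow x n i).2.1 ∧ 0 ≤ (envRow x n i).2.2 := by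
      unfold envRow
      obtain ⟨a1, a2, a3, _⟩ := hx 1
      obtain ⟨b1, b2, b3, _⟩ := hx n
      obtain ⟨c1, c2, c3, _⟩ := hx ((i:ℕ)+1)
      split_ifs
      · exact ⟨le_rfl, a2.1, add_nonneg a1.1 a3.1⟩
      · exact ⟨add_nonneg b1.1 b3.1, b2.1, le_rfl⟩
      · exact ⟨c1.1, c2.1, c3.1⟩
    unfold Kbd
    split_ifs
    · exact hrow.2.2
    · exact hrow.2.1
    · exact hrow.1
    · exact le_rfl
  · intro i
    have := Kbd_sum n (envRow x n) i (fun _ => 1)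
    simp only [mul_one] at this
    rw [this]
    unfold envRow
    obtain ⟨_, _, _, a4⟩ := hx 1
    obtain ⟨_, _, _, b4⟩ := hx n
    obtain ⟨_, _, _, c4⟩ := hx ((i:ℕ)+1)
    by_cases h0 : (i:ℕ) = 0
    · have : (i:ℕ) + 1 < n := by omega
      simp [h0, (by omega : 1 < n)]; linarith
    · by_cases h1 : (i:ℕ) = n - 1
      · have e1 : ¬ (i:ℕ) + 1 < n := by omega
        have e2 : 0 < (i:ℕ) := by omega
        rw [if_neg e1, if_pos e2, if_neg h0, if_pos h1]; simp only; linarith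
      · have e1 : (i:ℕ) + 1 < n := by omega
        have e2 : 0 < (i:ℕ) := by omega
        rw [if_pos e1, if_pos e2, if_neg h0, if_neg h1]; simp only; linarith

lemma envShift_iter (k : ℕ) (x : ℤ → ℝ × ℝ × ℝ) (i : ℤ) : (envShift^[k] x) i = x (i + k) := by
  induction k generalizing x i with
  | zero => simp
  | succ k ih =>
    rw [Function.iterate_succ_apply, ih]
    simp only [envShift]; congr 1; push_cast; ring

lemma Kbd_pow (x : ℤ → ℝ × ℝ × ℝ) (n : ℕ) (l : ℕ) : ∀ i j : Fin n, l ≤ (i:ℕ) → (i:ℕ) + l < n →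
    (Kbd n (envRow x n) ^ l) i j = retProb (envShift^[(j:ℕ)+1] x) l ((i:ℕ) - (j:ℕ)) := by
  induction l with
  | zero =>
    intro i j _ _
    simp only [pow_zero, Matrix.one_apply, retProb]
    by_cases h : i = j
    · simp [h]
    · have : ¬ ((i:ℕ):ℤ) - (j:ℕ) = 0 := by
        intro h'; apply h; apply Fin.ext; omega
      simp [h, this]
  | succ l ih =>
    intro i j h1 h2
    rw [pow_succ', Matrix.mul_apply]
    have hs : ∑ k, Kbd n (envRow x n) i k * (Kbd n (envRow x n) ^ l) k j =
        ∑ k : Fin n, Kbd n (envRow x n) i k *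
          (fun z : ℤ => retProb (envShift^[(j:ℕ)+1] x) l (z - (j:ℕ))) (k:ℕ) := by
      apply Finset.sum_congr rfl
      intro k _
      by_cases hk : (k:ℕ) ≤ (i:ℕ) + 1 ∧ (i:ℕ) ≤ (k:ℕ) + 1
      · rw [ih k j (by omega) (by omega)]
      · have : Kbd n (envRow x n) i k = 0 := by
          unfold Kbd
          have e2 : k ≠ i := by rintro rfl; omega
          rw [if_neg (by omega), if_neg e2, if_neg (by omega)]
        rw [this]; simp
    have hs2 := hs.trans (Kbd_sum n (envRow x n) i
      (fun z : ℤ => retProb (envShift^[(j:ℕ)+1] x) l (z - (j:ℕ))))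
    rw [if_pos (by omega), if_pos (by omega)] at hs2
    refine hs2.trans ?_
    have hr : envRow x n i = x ((i:ℕ)+1) := by
      unfold envRow
      rw [if_neg (by omega), if_neg (by omega)]
    rw [hr]
    simp only [retProb]
    rw [envShift_iter]
    have e1 : ((i:ℕ):ℤ) - (j:ℕ) + (((j:ℕ)+1 : ℕ) : ℤ) = (i:ℕ) + 1 := by push_cast; ring
    have e2 : ((i:ℕ):ℤ) + 1 - (j:ℕ) = (i:ℕ) - (j:ℕ) + 1 := by ring
    have e3 : ((i:ℕ):ℤ) - 1 - (j:ℕ) = (i:ℕ) - (j:ℕ) - 1 := by ring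
    rw [e1, e2, e3]; ring

lemma retProb_mem {x : ℤ → ℝ × ℝ × ℝ} (hx : ∀ i, memSimplex (x i)) (l : ℕ) :
    ∀ i, retProb x l i ∈ Set.Icc (0:ℝ) 1 := by
  induction l with
  | zero => intro i; simp only [retProb]; split_ifs <;> simp
  | succ l ih =>
    intro i
    obtain ⟨a1, a2, a3, a4⟩ := hx i
    have b1 := ih (i-1)
    have b2 := ih i
    have b3 := ih (i+1)
    simp only [retProb]
    constructor
    · have := mul_nonneg a1.1 b1.1
      have := mul_nonneg a2.1 b2.1
      have := mul_nonneg a3.1 b3.1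
      linarith
    · have := mul_le_mul_of_nonneg_left b1.2 a1.1
      have := mul_le_mul_of_nonneg_left b2.2 a2.1
      have := mul_le_mul_of_nonneg_left b3.2 a3.1
      linarith

lemma retProb_meas (l : ℕ) : ∀ i, Measurable (fun x => retProb x l i) := by
  induction l with
  | zero => intro i; simp only [retProb]; exact measurable_const
  | succ l ih =>
    intro i
    simp only [retProb]
    have h1 := ih (i-1)
    have h2 := ih i
    have h3 := ih (i+1)
    have h0 : Measurable (fun x : ℤ → ℝ × ℝ × ℝ => x i) := measurable_pi_apply i
    exact ((h0.fst.mul h1).add (h0.snd.fst.mul h2)).add (h0.snd.snd.mul h3)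

lemma trace_close {x : ℤ → ℝ × ℝ × ℝ} (hx : ∀ i, memSimplex (x i)) {n : ℕ} (hn : 2 ≤ n) (l : ℕ) :
    |(Kbd n (envRow x n) ^ l).trace -
      birkhoffSum envShift (fun y => retProb (envShift y) l 0) n x| ≤ 2 * l := by
  have hst := Submonoid.pow_mem _ (Kbd_stoch hx hn) l
  have hb : birkhoffSum envShift (fun y => retProb (envShift y) l 0) n x =
      ∑ j : Fin n, retProb (envShift^[(j:ℕ)+1] x) l 0 := by
    unfold birkhoffSum
    rw [Finset.sum_range]
    simp only [Function.iterate_succ_apply']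
  have hxs : ∀ k : ℕ, ∀ i, memSimplex ((envShift^[k] x) i) := by
    intro k i; rw [envShift_iter]; exact hx _
  rw [hb, Matrix.trace, ← Finset.sum_sub_distrib]
  refine (Finset.abs_sum_le_sum_abs _ _).trans ?_
  have hterm : ∀ j : Fin n, |(Kbd n (envRow x n) ^ l).diag j - retProb (envShift^[(j:ℕ)+1] x) l 0| ≤
      (if (j:ℕ) < l then 1 else 0) + (if n ≤ (j:ℕ) + l then 1 else 0) := by
    intro j
    by_cases h : l ≤ (j:ℕ) ∧ (j:ℕ) + l < n
    · rw [Matrix.diag_apply, Kbd_pow x n l j j h.1 h.2]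
      simp only [sub_self, abs_zero]
      positivity
    · have h1 : (Kbd n (envRow x n) ^ l).diag j ∈ Set.Icc (0:ℝ) 1 :=
        ⟨Matrix.nonneg_of_mem_rowStochastic hst, Matrix.le_one_of_mem_rowStochastic hst⟩
      have h2 := retProb_mem (hxs ((j:ℕ)+1)) l 0
      have h3 : |(Kbd n (envRow x n) ^ l).diag j - retProb (envShift^[(j:ℕ)+1] x) l 0| ≤ 1 := by
        rw [abs_le]; constructor <;> linarith [h1.1, h1.2, h2.1, h2.2]
      refine h3.trans ?_
      by_cases h4 : (j:ℕ) < l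
      · rw [if_pos h4]; split_ifs <;> norm_num
      · have : n ≤ (j:ℕ) + l := by omega
        rw [if_pos this]; split_ifs <;> norm_num
  refine (Finset.sum_le_sum fun j _ => hterm j).trans ?_
  rw [Finset.sum_add_distrib, Finset.sum_boole, Finset.sum_boole]
  have c1 : (Finset.univ.filter fun j : Fin n => (j:ℕ) < l).card ≤ l := by
    calc _ ≤ (Finset.range l).card := Finset.card_le_card_of_injOn (fun j : Fin n => (j:ℕ))
            (by intro j hj; simpa using hj) (by intro a _ b _ hab; exact Fin.ext hab)
      _ = l := by simp
  have c2 : (Finset.univ.filter fun j : Fin n => n ≤ (j:ℕ) + l).card ≤ l := by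
    calc _ ≤ (Finset.range l).card := Finset.card_le_card_of_injOn (fun j : Fin n => n - 1 - (j:ℕ))
            (by intro j hj
                have := j.2
                simp at hj ⊢; omega)
            (by intro a _ b _ hab
                have := a.2
                have := b.2
                simp only at hab
                exact Fin.ext (by omega))
      _ = l := by simp
  have c1' : ((Finset.univ.filter fun j : Fin n => (j:ℕ) < l).card : ℝ) ≤ l := by exact_mod_cast c1
  have c2' : ((Finset.univ.filter fun j : Fin n => n ≤ (j:ℕ) + l).card : ℝ) ≤ l := by exact_mod_cast c2
  linarith

lemma stoch_root {n : ℕ} {M : Matrix (Fin n) (Fin n) ℝ} (hM : M ∈ Matrix.rowStochastic ℝ (Fin n))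
    {r : ℝ} (hr : M.charpoly.IsRoot r) : r ∈ Set.Icc (-1:ℝ) 1 := by
  have he : Module.End.HasEigenvalue (Matrix.toLin' M) r := by
    rw [Module.End.hasEigenvalue_iff_isRoot_charpoly, Matrix.charpoly_toLin']
    exact hr
  obtain ⟨k, hk⟩ := eigenvalue_mem_ball he
  have hs := Matrix.sum_row_of_mem_rowStochastic hM k
  rw [← Finset.add_sum_erase _ _ (Finset.mem_univ k)] at hs
  have h2 : ∑ j ∈ Finset.univ.erase k, ‖M k j‖ = ∑ j ∈ Finset.univ.erase k, M k j :=
    Finset.sum_congr rfl fun j _ => by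
      rw [Real.norm_eq_abs, abs_of_nonneg (Matrix.nonneg_of_mem_rowStochastic hM)]
  rw [h2, Metric.mem_closedBall, Real.dist_eq, abs_le] at hk
  have h0 : 0 ≤ M k k := Matrix.nonneg_of_mem_rowStochastic hM
  constructor <;> linarith [hk.1, hk.2]
end walk

section final
/-- Empirical measure on the compact interval. -/
noncomputable def empII (n : ℕ) (v : Fin n → II) : Measure II :=
  ((n : ENNReal))⁻¹ • ∑ k : Fin n, Measure.dirac (v k)

lemma empII_prob {n : ℕ} (hn : 0 < n) (v : Fin n → II) : IsProbabilityMeasure (empII n v) := by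
  constructor
  simp only [empII, Measure.smul_apply, Measure.finset_sum_apply, measure_univ, smul_eq_mul]
  simp only [Finset.sum_const, Finset.card_univ, Fintype.card_fin, nsmul_eq_mul, mul_one]
  exact ENNReal.inv_mul_cancel (by exact_mod_cast hn.ne') (ENNReal.natCast_ne_top n)

lemma empII_integral (n : ℕ) (v : Fin n → II) (l : ℕ) :
    ∫ t : II, (t:ℝ)^l ∂(empII n v) = (∑ k, (v k : ℝ)^l) / n := by
  unfold empII
  rw [integral_smul_measure, integral_finsetSum_measure]
  · simp [div_eq_inv_mul]
  · intro k _
    exact integrable_dirac (by simp)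

lemma empII_map (n : ℕ) (v : Fin n → II) :
    (empII n v).map Subtype.val = empMeasure n (fun k => (v k : ℝ)) := by
  unfold empII empMeasure
  rw [Measure.map_smul]
  congr 1
  rw [← Measure.mapₗ_apply_of_measurable measurable_subtype_coe, map_sum]
  refine Finset.sum_congr rfl fun k _ => ?_
  rw [Measure.mapₗ_apply_of_measurable measurable_subtype_coe]
  exact Measure.map_dirac' measurable_subtype_coe _

lemma map_val_compl (Q : Measure II) : Q.map Subtype.val (Set.Icc (-1 : ℝ) 1)ᶜ = 0 := by
  rw [Measure.map_apply measurable_subtype_coe measurableSet_Icc.compl]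
  convert measure_empty (μ := Q)
  ext t
  simp only [Set.mem_preimage, Set.mem_compl_iff, Set.mem_empty_iff_false, iff_false, not_not]
  exact t.2

lemma Wdist_of_weak {P : ℕ → ProbabilityMeasure II} {Q : ProbabilityMeasure II}
    (h : Tendsto P atTop (𝓝 Q)) {p : ℝ} (hp : 1 ≤ p) :
    Tendsto (fun n => Wdist p ((P n : Measure II).map Subtype.val) ((Q : Measure II).map Subtype.val))
      atTop (𝓝 0) := by
  have i1 : IsProbabilityMeasure ((Q : Measure II).map Subtype.val) :=
    Measure.isProbabilityMeasure_map measurable_subtype_coe.aemeasurable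
  have i2 : ∀ n, IsProbabilityMeasure ((P n : Measure II).map Subtype.val) := fun n =>
    Measure.isProbabilityMeasure_map measurable_subtype_coe.aemeasurable
  refine Wdist_tendsto (map_val_compl _) (fun n => map_val_compl _) ?_ hp
  intro t ht
  have h1 := ProbabilityMeasure.tendsto_map_of_tendsto_of_continuous P Q h
    (f := (Subtype.val : II → ℝ)) continuous_subtype_val
  have h2 := ProbabilityMeasure.tendsto_measure_of_null_frontier_of_tendsto' h1 (E := Set.Iic t)
    (by rw [frontier_Iic]; exact ht)
  simp only [cdf_eq_real, measureReal_def]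
  exact (ENNReal.tendsto_toReal (measure_ne_top _ _)).comp h2
end final

/-- **Global behavior for ergodic environment (Theorem 1.6).** Let `ν` be a shift-invariant
ergodic probability law on environments `p : ℤ → Λ₃` and let `K = K^{(n)}` be the random
birth-and-death kernel built from `p` with reflecting boundary rows. Then there is a
non-random probability measure `μ` on `[−1,1]` such that almost surely
`W_p(μ_K, μ) → 0` for every `p ≥ 1`, and whose moments are
`∫ x^ℓ dμ = E[r_ℓ^p(0)]`, the mean return probability of the random walk on `ℤ` in the
environment.  The (real) eigenvalues of `K` are encoded by `lam`, which almost surely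
factorizes the characteristic polynomial of `K`. -/
theorem chain_ergodic_bulk
    (ν : Measure (ℤ → ℝ × ℝ × ℝ)) [IsProbabilityMeasure ν]
    (hshift : Ergodic envShift ν)
    (hΛ : ∀ᵐ x ∂ν, ∀ i : ℤ, memSimplex (x i))
    (lam : (n : ℕ) → (ℤ → ℝ × ℝ × ℝ) → Fin n → ℝ)
    (hlam : ∀ᵐ x ∂ν, ∀ n,
      (Kbd n (envRow x n)).charpoly = ∏ k : Fin n, (X - C (lam n x k))) :
    ∃ μ : Measure ℝ, IsProbabilityMeasure μ ∧ μ (Set.Icc (-1 : ℝ) 1)ᶜ = 0 ∧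
      (∀ ℓ : ℕ, ∫ t, t ^ ℓ ∂μ = ∫ x, retProb x ℓ 0 ∂ν) ∧
      (∀ᵐ x ∂ν, ∀ p : ℝ, 1 ≤ p →
        Tendsto (fun n : ℕ => Wdist p (empMeasure n (lam n x)) μ) atTop (𝓝 0)) := by
  have hgood : ∀ᵐ x ∂ν, ∃ P : ℕ → ProbabilityMeasure II,
      (∀ n, (P n : Measure II).map Subtype.val = empMeasure (n+2) (lam (n+2) x)) ∧
      ∀ l : ℕ, Tendsto (fun n => ∫ t : II, (t:ℝ)^l ∂(P n : Measure II)) atTop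
        (𝓝 (∫ x, retProb x l 0 ∂ν)) := by
    have hbirk : ∀ l : ℕ, ∀ᵐ x ∂ν, Tendsto (fun n : ℕ =>
        birkhoffSum envShift (fun y => retProb (envShift y) l 0) n x / n) atTop
        (𝓝 (∫ x, retProb x l 0 ∂ν)) := by
      intro l
      have hSm := hshift.toMeasurePreserving.measurable
      have hi : Integrable (fun x => retProb x l 0) ν := by
        refine Integrable.of_bound (retProb_meas l 0).aestronglyMeasurable 1 ?_
        filter_upwards [hΛ] with x hx
        have := retProb_mem hx l 0
        rw [Real.norm_eq_abs, abs_of_nonneg this.1]; exact this.2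
      have hb := birkhoff_ergodic hshift ((retProb_meas l 0).comp hSm)
        (hshift.toMeasurePreserving.integrable_comp_of_integrable hi)
      have he : ∫ x, ((fun x => retProb x l 0) ∘ envShift) x ∂ν = ∫ x, retProb x l 0 ∂ν := by
        have := integral_map (μ := ν) hSm.aemeasurable (f := fun x => retProb x l 0)
          (retProb_meas l 0).aestronglyMeasurable
        rw [hshift.toMeasurePreserving.map_eq] at this
        exact this.symm
      rw [he] at hb
      exact hb
    filter_upwards [hΛ, hlam, ae_all_iff.2 hbirk] with x hx hl hb
    have hmem : ∀ n, ∀ k, lam (n+2) x k ∈ Set.Icc (-1:ℝ) 1 := by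
      intro n k
      refine stoch_root (Kbd_stoch hx (by omega : 2 ≤ n + 2)) ?_
      rw [hl (n+2), Polynomial.IsRoot, eval_prod]
      exact Finset.prod_eq_zero (Finset.mem_univ k) (by simp)
    refine ⟨fun n => ⟨empII (n+2) (fun k => ⟨lam (n+2) x k, hmem n k⟩), empII_prob (by omega) _⟩,
      fun n => empII_map _ _, fun l => ?_⟩
    have hm : ∀ n, ∫ t : II, (t:ℝ)^l ∂(empII (n+2) (fun k => ⟨lam (n+2) x k, hmem n k⟩)) =
        (Kbd (n+2) (envRow x (n+2)) ^ l).trace / (n+2 : ℕ) := by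
      intro n
      rw [empII_integral, trace_pow_real _ _ (hl (n+2))]
    have hb2 := (tendsto_add_atTop_iff_nat 2).2 (hb l)
    have hd : Tendsto (fun n : ℕ => (2 * (l:ℝ)) / ((n + 2 : ℕ) : ℝ)) atTop (𝓝 0) :=
      (tendsto_add_atTop_iff_nat 2).2 (tendsto_const_div_atTop_nhds_zero_nat (2 * (l:ℝ)))
    refine (tendsto_congr hm).2 ?_
    refine tendsto_of_tendsto_of_dist hb2 ?_
    refine squeeze_zero (fun _ => dist_nonneg) (fun n => ?_) hd
    rw [dist_comm, Real.dist_eq, ← sub_div, abs_div, Nat.abs_cast]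
    exact div_le_div_of_nonneg_right (trace_close hx (by omega) l) (Nat.cast_nonneg _)
  obtain ⟨x₀, P₀, -, hP₀⟩ := hgood.exists
  obtain ⟨Q, hQ⟩ := moments_exists hP₀
  refine ⟨(Q : Measure II).map Subtype.val,
    Measure.isProbabilityMeasure_map measurable_subtype_coe.aemeasurable, map_val_compl _, ?_, ?_⟩
  · intro l
    rw [integral_map measurable_subtype_coe.aemeasurable
      (by fun_prop : Continuous fun t : ℝ => t ^ l).aestronglyMeasurable]
    exact hQ l
  · filter_upwards [hgood] with x hx p hp
    obtain ⟨P, hP, hPl⟩ := hx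
    have hw := moments_tendsto (P := P) (Q := Q) (fun l => by rw [hQ l]; exact hPl l)
    rw [← tendsto_add_atTop_iff_nat 2]
    refine (Wdist_of_weak hw hp).congr fun n => ?_
    rw [hP n]
end

section
/- Fix p ∈ (0,1) and let K = K^{(n)} be the (deterministic) tridiagonal Markov matrix on {1,…,n} with zero diagonal, K_{1,2} = K_{n,n−1} = 1, and K_{i,i+1} = p = 1 − K_{i,i−1} for 2 ≤ i ≤ n−1. Then the empirical spectral distribution μ_K converges weakly, as n → ∞, to the arc-sine law on [−2√(p(1−p)), +2√(p(1−p))], i.e. the probability measure with density x ↦ 1/(π·√(4p(1−p) − x²)) on that interval; equivalently, the limit μ has vanishing odd moments and ∫ x^{2k} dμ(x) = (p(1−p))^k · binomial(2k, k) for all k ≥ 1. -/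
open MeasureTheory Filter Polynomial Topology

/-- The tridiagonal Markov matrix on `{1,…,n}` with zero diagonal:
`K_{i,i+1} = b_i` and `K_{i,i−1} = 1 − b_i` (row `j : Fin n` is the paper's row `i = j+1`). -/
def Kchain (n : ℕ) (b : Fin n → ℝ) : Matrix (Fin n) (Fin n) ℝ := fun i j =>
  if (j : ℕ) = (i : ℕ) + 1 then b i
  else if (i : ℕ) = (j : ℕ) + 1 then 1 - b i
  else 0

/-- The arc-sine law on `[−r, r]`, with density `x ↦ 1/(π·√(r² − x²))` there. -/
noncomputable def arcsineLaw (r : ℝ) : Measure ℝ :=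
  volume.withDensity fun x =>
    ENNReal.ofReal (Set.indicator (Set.Ioo (-r) r)
      (fun y => (Real.pi * Real.sqrt (r^2 - y^2))⁻¹) x)


lemma Kchain_mulVec (n : ℕ) (b : Fin n → ℝ) (v : ℕ → ℝ) (i : Fin n) :
    (Kchain n b).mulVec (fun j => v j) i =
      (if (i : ℕ) + 1 < n then b i * v (i + 1) else 0) +
      (if 0 < (i : ℕ) then (1 - b i) * v (i - 1) else 0) := by
  have h : ∀ j : Fin n, Kchain n b i j * v j =
      (if (j : ℕ) = i + 1 then b i * v (i+1) else 0) +
      (if (j : ℕ) + 1 = i then (1 - b i) * v (i-1) else 0) := by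
    intro j
    unfold Kchain
    by_cases h1 : (j : ℕ) = i + 1
    · simp [h1]
      intro h; omega
    · by_cases h2 : (i : ℕ) = j + 1
      · have h3 : (j : ℕ) ≠ j + 1 + 1 := by omega
        simp [h2, h3]
      · simp [h1, h2, Ne.symm h2]
  simp only [Matrix.mulVec, dotProduct, h, Finset.sum_add_distrib]
  congr 1
  · split_ifs with hi
    · rw [Finset.sum_eq_single (⟨i+1, hi⟩ : Fin n)]
      · simp
      · intro j _ hj
        rw [if_neg]; intro h; exact hj (Fin.ext h)
      · simp
    · apply Finset.sum_eq_zero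
      intro j _
      rw [if_neg]; have := j.2; omega
  · split_ifs with hi
    · rw [Finset.sum_eq_single (⟨i-1, by omega⟩ : Fin n)]
      · simp; omega
      · intro j _ hj
        rw [if_neg]; intro h; apply hj; apply Fin.ext; simp; omega
      · simp
    · apply Finset.sum_eq_zero
      intro j _
      rw [if_neg]; omega

lemma root_of_eigen (n : ℕ) (M : Matrix (Fin n) (Fin n) ℝ) (v : Fin n → ℝ) (l : ℝ)
    (hv : v ≠ 0) (h : ∀ i, M.mulVec v i = l * v i) : M.charpoly.eval l = 0 := by
  rw [Matrix.eval_charpoly]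
  apply Matrix.exists_mulVec_eq_zero_iff.1
  refine ⟨v, hv, ?_⟩
  ext i
  rw [Matrix.sub_mulVec]
  simp [h, Matrix.scalar_apply]

/-- The explicit eigenvalues. -/
noncomputable def mu (r : ℝ) (n : ℕ) (k : ℕ) : ℝ :=
  if k = 0 then 1 else if k = n - 1 then -1 else r * Real.cos (k * Real.pi / (n - 1))

noncomputable abbrev bb (p : ℝ) (n : ℕ) : Fin n → ℝ := fun j =>
        if (j : ℕ) = 0 then 1 else if (j : ℕ) = n - 1 then 0 else p

lemma eigen_one (p : ℝ) (n : ℕ) (hn : 3 ≤ n) (e : ℝ) (he : e * e = 1) :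
    (Kchain n (bb p n)).charpoly.eval e = 0 := by
  apply root_of_eigen n _ (fun j : Fin n => e ^ (j : ℕ))
  · intro h
    have := congrFun h ⟨0, by omega⟩
    simp at this
  · intro i
    rw [Kchain_mulVec n _ (fun j => e ^ j) i]
    obtain ⟨i, hi⟩ := i
    rcases i with _ | i
    · simp; omega
    · by_cases h : i + 1 = n - 1
      · have : ¬ (i + 1 + 1 < n) := by omega
        simp [bb, h]
        have h3 : n - 1 ≠ 0 := by omega
        have h2 : ¬ (n - 1 + 1 < n) := by omega
        rw [← h]
        have h1n : 1 < n := by omega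
        simp [this, h1n]
        linear_combination -(e^i) * he
      · have : i + 1 + 1 < n := by omega
        simp [bb, h, this]
        linear_combination (p-1) *(e^i) * he

lemma eigen_cos (p s : ℝ) (hp : 0 < p) (hp1 : p < 1) (hs : 0 < s) (hs2 : s ^ 2 = p * (1 - p))
    (n : ℕ) (hn : 3 ≤ n) (t : ℝ) (hst : Real.sin t ≠ 0) (hnt : Real.sin ((n - 1) * t) = 0) :
    (Kchain n (bb p n)).charpoly.eval (2 * s * Real.cos t) = 0 := by
  set w : ℕ → ℝ := fun j => (s / p) ^ j *
    (Real.sin t * Real.cos (j * t) + (2 * p - 1) * Real.cos t * Real.sin (j * t)) with hw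
  apply root_of_eigen n _ (fun j : Fin n => w j)
  · intro h
    have := congrFun h ⟨0, by omega⟩
    simp [hw] at this
    exact hst this
  · intro i
    rw [Kchain_mulVec n _ w i]
    obtain ⟨i, hi⟩ := i
    rcases i with _ | i
    · have : 1 < n := by omega
      simp [hw, this]
      field_simp
      ring
    · by_cases h : i + 1 = n - 1
      · have h3 : ¬ (i + 1 + 1 < n) := by omega
        have hn1 : (n : ℝ) - 1 = i + 1 := by
          have : n = i + 2 := by omega
          rw [this]; push_cast; ring
        rw [hn1] at hnt
        have e1 : Real.cos (i * t) = Real.cos ((i+1) * t) * Real.cos t := by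
          have : (i : ℝ) * t = (i+1) * t - t := by ring
          rw [this, Real.cos_sub, hnt]; ring
        have e2 : Real.sin (i * t) = - Real.cos ((i+1) * t) * Real.sin t := by
          have : (i : ℝ) * t = (i+1) * t - t := by ring
          rw [this, Real.sin_sub, hnt]; ring
        have e4 : s * (s / p) = 1 - p := by field_simp; linarith
        simp only [bb, h3, h]
        have h5 : n - 1 ≠ 0 := by omega
        rw [← h]
        simp [hw, hnt, e1, e2, pow_succ]
        linear_combination (-2 * (s/p)^i * Real.cos t * Real.sin t * Real.cos ((i+1) * t)) * e4
      · have h3 : i + 1 + 1 < n := by omega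
        have e1 : Real.cos (i * t) = Real.cos ((i+1) * t) * Real.cos t + Real.sin ((i+1) * t) * Real.sin t := by
          have : (i : ℝ) * t = (i+1) * t - t := by ring
          rw [this, Real.cos_sub]
        have e2 : Real.sin (i * t) = Real.sin ((i+1) * t) * Real.cos t - Real.cos ((i+1) * t) * Real.sin t := by
          have : (i : ℝ) * t = (i+1) * t - t := by ring
          rw [this, Real.sin_sub]
        have e3 : Real.cos ((i+1+1) * t) = Real.cos ((i+1) * t) * Real.cos t - Real.sin ((i+1) * t) * Real.sin t := by
          have : ((i : ℝ)+1+1) * t = (i+1) * t + t := by ring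
          rw [this, Real.cos_add]
        have e5 : Real.sin ((i+1+1) * t) = Real.sin ((i+1) * t) * Real.cos t + Real.cos ((i+1) * t) * Real.sin t := by
          have : ((i : ℝ)+1+1) * t = (i+1) * t + t := by ring
          rw [this, Real.sin_add]
        have e4 : s * (s / p) = 1 - p := by field_simp; linarith
        have e6 : p * (s / p) = s := by field_simp
        simp [bb, h, h3, hw, pow_succ, e1, e2, e3, e5]
        generalize Real.cos ((i+1) * t) = c at *
        generalize Real.sin ((i+1) * t) = d at *
        rw [← e4]
        have : p * ((s/p)^i * (s/p) * (s/p) * (Real.sin t * (c * Real.cos t - d * Real.sin t) + (2 * p - 1) * Real.cos t * (d * Real.cos t + c * Real.sin t))) = (s/p)^i * s * (s/p) * (Real.sin t * (c * Real.cos t - d * Real.sin t) + (2 * p - 1) * Real.cos t * (d * Real.cos t + c * Real.sin t)) := by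
          linear_combination ((s/p)^i * (s/p) * (Real.sin t * (c * Real.cos t - d * Real.sin t) + (2 * p - 1) * Real.cos t * (d * Real.cos t + c * Real.sin t))) * e6
        rw [this]
        ring

lemma mu_anti (r : ℝ) (hr : 0 < r) (hr1 : r ≤ 1) (n : ℕ) (hn : 3 ≤ n) (i j : ℕ) (hij : i < j)
    (hj : j < n) : mu r n j < mu r n i := by
  have hn1 : (0:ℝ) < (n:ℝ) - 1 := by
    have : (3:ℝ) ≤ n := by exact_mod_cast hn
    linarith
  have key : ∀ a b : ℕ, a < b → b < n → Real.cos (b * Real.pi / (n-1)) < Real.cos (a * Real.pi / (n-1)) := by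
    intro a b hab hb
    have hb' : (b:ℝ) + 1 ≤ n := by exact_mod_cast hb
    have hab' : (a:ℝ) < b := by exact_mod_cast hab
    have := Real.pi_pos
    apply Real.cos_lt_cos_of_nonneg_of_le_pi
    · positivity
    · rw [div_le_iff₀ hn1]; nlinarith
    · gcongr
  have k0 := key 0
  have k1 := fun a h => key a (n-1) h (by omega)
  have hc : ((n - 1 : ℕ) : ℝ) = n - 1 := by
    rw [Nat.cast_sub (by omega)]; simp
  have e0 : ((n:ℝ) - 1) * Real.pi / (n - 1) = Real.pi := by field_simp
  simp only [hc, e0, Real.cos_pi] at k1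
  simp at k0
  unfold mu
  have hj0 : j ≠ 0 := by omega
  have hin : i ≠ n - 1 := by omega
  by_cases hi0 : i = 0 <;> by_cases hjn : j = n - 1
  · have : n - 1 ≠ 0 := by omega
    simp [hi0, hjn, this]
  · have := k0 j (by omega) hj
    simp [hi0, hjn, hj0]; nlinarith
  · have := k1 i (by omega)
    have h2 : n - 1 ≠ 0 := by omega
    simp [hi0, hjn, hin, h2]; nlinarith
  · have := key i j hij hj
    simp [hi0, hjn, hin, hj0]; nlinarith

lemma sum_lam (p s : ℝ) (hp : 0 < p) (hp1 : p < 1) (hs : 0 < s) (hs2 : s ^ 2 = p * (1 - p))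
    (n : ℕ) (hn : 3 ≤ n) (lam : Fin n → ℝ)
    (hlam : (Kchain n (bb p n)).charpoly = ∏ k : Fin n, (X - C (lam k))) (f : ℝ → ℝ) :
    ∑ k, f (lam k) = ∑ k ∈ Finset.range n, f (mu (2 * s) n k) := by
  have hr1 : 2 * s ≤ 1 := by nlinarith [sq_nonneg (2*p-1)]
  have hn1 : (0:ℝ) < (n:ℝ) - 1 := by
    have : (3:ℝ) ≤ n := by exact_mod_cast hn
    linarith
  have hroot : ∀ k : Fin n, (Kchain n (bb p n)).charpoly.eval (mu (2*s) n k) = 0 := by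
    intro k
    unfold mu
    split_ifs with h1 h2
    · exact eigen_one p n hn 1 (by norm_num)
    · exact eigen_one p n hn (-1) (by norm_num)
    · apply eigen_cos p s hp hp1 hs hs2 n hn
      · apply ne_of_gt
        have hb' : ((k:ℕ):ℝ) + 1 < n := by
          have := k.2
          exact_mod_cast (by omega : (k:ℕ) + 1 < n)
        have h0 : (0:ℝ) < ((k:ℕ):ℝ) := by exact_mod_cast Nat.pos_of_ne_zero h1
        have := Real.pi_pos
        apply Real.sin_pos_of_pos_of_lt_pi
        · positivity
        · rw [div_lt_iff₀ hn1]; nlinarith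
      · have : ((n:ℝ) - 1) * (((k:ℕ):ℝ) * Real.pi / (n-1)) = ((k:ℕ):ℝ) * Real.pi := by field_simp
        rw [this, Real.sin_nat_mul_pi]
  have hex : ∀ k : Fin n, ∃ j, lam j = mu (2*s) n k := by
    intro k
    have := hroot k
    rw [hlam, eval_prod, Finset.prod_eq_zero_iff] at this
    obtain ⟨j, _, hj⟩ := this
    simp [sub_eq_zero] at hj
    exact ⟨j, hj.symm⟩
  choose σ hσ using hex
  have hinj : Function.Injective σ := by
    intro a b hab
    have h : mu (2*s) n a = mu (2*s) n b := by rw [← hσ, ← hσ, hab]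
    rcases lt_trichotomy a b with h' | h' | h'
    · have := mu_anti (2*s) (by linarith) hr1 n hn a b h' b.2; linarith
    · exact h'
    · have := mu_anti (2*s) (by linarith) hr1 n hn b a h' a.2; linarith
  have hbij : Function.Bijective σ := Finite.injective_iff_bijective.1 hinj
  rw [← hbij.sum_comp (fun k => f (lam k)), Finset.sum_range]
  simp [hσ]

lemma integral_arcsine (r : ℝ) (hr : 0 < r) (f : ℝ → ℝ) :
    ∫ x, f x ∂ arcsineLaw r = (1 / Real.pi) * ∫ t in (0:ℝ)..Real.pi, f (r * Real.cos t) := by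
  unfold arcsineLaw
  have him : (fun t => r * Real.cos t) '' Set.Ioo 0 Real.pi = Set.Ioo (-r) r := by
    ext x
    constructor
    · rintro ⟨t, ⟨h0, h1⟩, rfl⟩
      have a1 : Real.cos t < 1 := by
        have := Real.cos_lt_cos_of_nonneg_of_le_pi le_rfl h1.le h0
        simpa using this
      have a2 : -1 < Real.cos t := by
        have := Real.cos_lt_cos_of_nonneg_of_le_pi h0.le le_rfl h1
        simpa using this
      constructor <;> simp only <;> nlinarith
    · rintro ⟨h0, h1⟩
      have b1 : -1 < x / r := by rw [lt_div_iff₀ hr]; linarith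
      have b2 : x / r < 1 := by rw [div_lt_iff₀ hr]; linarith
      refine ⟨Real.arccos (x / r), ⟨Real.arccos_pos.2 b2, ?_⟩, ?_⟩
      · apply lt_of_le_of_ne (Real.arccos_le_pi _)
        intro h
        rw [Real.arccos_eq_pi] at h
        linarith
      · simp only [Real.cos_arccos b1.le b2.le]
        field_simp
  rw [integral_withDensity_eq_integral_toReal_smul]
  · have h1 : ∀ x, (ENNReal.ofReal (Set.indicator (Set.Ioo (-r) r)
      (fun y => (Real.pi * Real.sqrt (r^2 - y^2))⁻¹) x)).toReal • f x =
      Set.indicator (Set.Ioo (-r) r) (fun y => (Real.pi * Real.sqrt (r^2 - y^2))⁻¹ * f y) x := by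
      intro x
      rw [ENNReal.toReal_ofReal]
      · by_cases hx : x ∈ Set.Ioo (-r) r
        · simp only [Set.indicator_of_mem hx, smul_eq_mul]
        · simp only [Set.indicator_of_notMem hx, zero_smul]
      · apply Set.indicator_nonneg
        intro y _
        have := Real.pi_pos
        positivity
    simp_rw [h1]
    rw [integral_indicator measurableSet_Ioo, ← him,
      integral_image_eq_integral_abs_deriv_smul (f' := fun t => r * (- Real.sin t)) measurableSet_Ioo,
      intervalIntegral.integral_of_le Real.pi_pos.le, integral_Ioc_eq_integral_Ioo,
      ← integral_const_mul]
    · apply setIntegral_congr_fun measurableSet_Ioo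
      intro t ht
      have hs := Real.sin_pos_of_mem_Ioo ht
      have e : r^2 - (r * Real.cos t)^2 = (r * Real.sin t)^2 := by
        rw [mul_pow, mul_pow, Real.sin_sq]; ring
      have hpi := Real.pi_pos
      simp only [e]
      rw [Real.sqrt_sq (by positivity), mul_neg, abs_neg, abs_of_pos (by positivity), smul_eq_mul]
      field_simp
    · intro t _
      exact ((Real.hasDerivAt_cos t).const_mul r).hasDerivWithinAt
    · intro a ha b hb hab
      apply Real.injOn_cos ⟨ha.1.le, ha.2.le⟩ ⟨hb.1.le, hb.2.le⟩
      exact mul_left_cancel₀ hr.ne' hab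
  · apply Measurable.ennreal_ofReal
    apply Measurable.indicator _ measurableSet_Ioo
    fun_prop
  · simp

lemma int_cos_even (k : ℕ) : ∫ t in (0:ℝ)..Real.pi, Real.cos t ^ (2 * k) =
    Real.pi * (Nat.centralBinom k) / 4 ^ k := by
  induction k with
  | zero => simp
  | succ k ih =>
    rw [show 2 * (k + 1) = 2 * k + 2 by ring, integral_cos_pow, ih]
    have h := Nat.succ_mul_centralBinom_succ k
    have h' : ((k:ℝ) + 1) * Nat.centralBinom (k+1) = 2 * (2 * k + 1) * Nat.centralBinom k := by
      exact_mod_cast h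
    have h2 : (Nat.centralBinom (k+1) : ℝ) = 2 * (2 * k + 1) * Nat.centralBinom k / (k+1) := by
      field_simp; linarith
    rw [h2]
    simp
    field_simp
    ring

lemma int_cos_odd (k : ℕ) : ∫ t in (0:ℝ)..Real.pi, Real.cos t ^ (2 * k + 1) = 0 := by
  have h := intervalIntegral.integral_comp_sub_left (a := 0) (b := Real.pi)
    (fun t => Real.cos t ^ (2 * k + 1)) Real.pi
  simp only [Real.cos_pi_sub, sub_self, sub_zero, Odd.neg_pow (⟨k, rfl⟩ : Odd (2*k+1)),
    intervalIntegral.integral_neg] at h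
  linarith

/-- Riemann sums on `[0, π]`. -/
lemma riemann (g : ℝ → ℝ) (hg : Continuous g) :
    Tendsto (fun n : ℕ => (Real.pi / (n + 1 : ℝ)) * ∑ k ∈ Finset.range (n+1), g (k * Real.pi / (n + 1 : ℝ)))
      atTop (𝓝 (∫ t in (0:ℝ)..Real.pi, g t)) := by
  rw [Metric.tendsto_atTop]
  intro ε hε
  have hpi := Real.pi_pos
  have huc := (isCompact_Icc (a := (0:ℝ)) (b := Real.pi)).uniformContinuousOn_of_continuous hg.continuousOn
  rw [Metric.uniformContinuousOn_iff_le] at huc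
  obtain ⟨δ, hδ, hd⟩ := huc (ε / (2 * Real.pi)) (by positivity)
  obtain ⟨N, hN⟩ := exists_nat_gt (Real.pi / δ)
  refine ⟨N, fun n hn => ?_⟩
  have hnN : (N:ℝ) ≤ n := by exact_mod_cast hn
  have hn0 : (0:ℝ) < n + 1 := by positivity
  have hw : Real.pi / (n+1) ≤ δ := by
    rw [div_lt_iff₀ hδ] at hN
    rw [div_le_iff₀ hn0]; nlinarith
  set a : ℕ → ℝ := fun k => k * Real.pi / (n + 1 : ℝ) with ha
  have hdiff : ∀ k, a (k+1) - a k = Real.pi / (n+1) := by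
    intro k; simp only [ha]; push_cast; ring
  have hwp : 0 < Real.pi / ((n:ℝ)+1) := by positivity
  have hsum := intervalIntegral.sum_integral_adjacent_intervals (μ := volume) (f := g) (a := a) (n := n+1)
    (fun k _ => hg.intervalIntegrable _ _)
  have ha0 : a 0 = 0 := by simp [ha]
  have han : a (n+1) = Real.pi := by simp only [ha]; push_cast; field_simp
  rw [ha0, han] at hsum
  rw [← hsum, dist_eq_norm, Finset.mul_sum, ← Finset.sum_sub_distrib]
  have hterm : ∀ k ∈ Finset.range (n+1), ‖Real.pi / (n+1) * g (a k) - ∫ x in a k..a (k+1), g x‖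
      ≤ ε / (2 * Real.pi) * (Real.pi / (n+1)) := by
    intro k hk
    have hk' : (k:ℝ) + 1 ≤ n + 1 := by exact_mod_cast Finset.mem_range.1 hk
    have e : Real.pi / (n+1) * g (a k) = ∫ x in a k..a (k+1), g (a k) := by
      rw [intervalIntegral.integral_const, hdiff, smul_eq_mul]
    have hle : a k ≤ a (k+1) := by linarith [hdiff k]
    have hk0 : 0 ≤ a k := by simp only [ha]; positivity
    have hk1 : a (k+1) ≤ Real.pi := by
      simp only [ha]; push_cast; rw [div_le_iff₀ hn0]; nlinarith
    rw [e, ← intervalIntegral.integral_sub (by simp) (hg.intervalIntegrable _ _)]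
    have := intervalIntegral.norm_integral_le_of_norm_le_const (a := a k) (b := a (k+1))
      (f := fun x => g (a k) - g x) (C := ε / (2 * Real.pi)) ?_
    · rwa [hdiff, abs_of_pos hwp] at this
    · intro x hx
      rw [Set.uIoc_of_le hle] at hx
      rw [← dist_eq_norm]
      apply hd _ ⟨hk0, by linarith⟩ _ ⟨by linarith [hx.1], by linarith [hx.2]⟩
      rw [dist_comm, Real.dist_eq, abs_of_pos (by linarith [hx.1])]
      linarith [hdiff k, hx.2]
  refine lt_of_le_of_lt (norm_sum_le_of_le _ hterm) ?_
  simp only [Finset.sum_const, Finset.card_range, nsmul_eq_mul]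
  push_cast
  have : ((n:ℝ) + 1) * (ε / (2 * Real.pi) * (Real.pi / (n+1))) = ε / 2 := by field_simp
  rw [this]; linarith

lemma integral_emp (n : ℕ) (v : Fin n → ℝ) (f : BoundedContinuousFunction ℝ ℝ) :
    ∫ x, f x ∂ empMeasure n v = (1 / (n:ℝ)) * ∑ k, f (v k) := by
  unfold empMeasure
  rw [integral_smul_measure, integral_finsetSum_measure]
  · simp
  · intro i _
    exact f.integrable _

lemma sum_mu (r : ℝ) (m : ℕ) (f : ℝ → ℝ) :
    ∑ k ∈ Finset.range (m + 2), f (mu r (m + 2) k) =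
      (f (-1) + f 1 - f r) +
        ∑ k ∈ Finset.range (m + 1), f (r * Real.cos (k * Real.pi / (m + 1 : ℝ))) := by
  rw [Finset.sum_range_succ, Finset.sum_range_succ', Finset.sum_range_succ']
  have h1 : ∀ k ∈ Finset.range m, f (mu r (m+2) (k+1)) =
      f (r * Real.cos (((k+1 : ℕ) : ℝ) * Real.pi / (m + 1 : ℝ))) := by
    intro k hk
    have hk' := Finset.mem_range.1 hk
    unfold mu
    rw [if_neg (by omega), if_neg (by omega)]
    congr 4
    push_cast; ring
  rw [Finset.sum_congr rfl h1]
  simp [mu]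
  ring

theorem chain_constant_arcsine
    (p : ℝ) (hp : 0 < p) (hp1 : p < 1)
    (lam : (n : ℕ) → Fin n → ℝ)
    (hlam : ∀ n,
      (Kchain n (fun j : Fin n =>
        if (j : ℕ) = 0 then 1 else if (j : ℕ) = n - 1 then 0 else p)).charpoly
        = ∏ k : Fin n, (X - C (lam n k))) :
    (∀ f : BoundedContinuousFunction ℝ ℝ,
      Tendsto (fun n : ℕ => ∫ x, f x ∂ empMeasure n (lam n)) atTop
        (𝓝 (∫ x, f x ∂ arcsineLaw (2 * Real.sqrt (p * (1 - p)))))) ∧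
    (∀ k : ℕ, 1 ≤ k →
      ∫ x, x ^ (2*k) ∂ arcsineLaw (2 * Real.sqrt (p * (1 - p)))
        = (p * (1 - p)) ^ k * (Nat.choose (2*k) k)) ∧
    (∀ k : ℕ, ∫ x, x ^ (2*k+1) ∂ arcsineLaw (2 * Real.sqrt (p * (1 - p))) = 0) := by
  have hpq : 0 < p * (1 - p) := mul_pos hp (by linarith)
  have hs : 0 < Real.sqrt (p * (1 - p)) := Real.sqrt_pos.2 hpq
  have hs2 : Real.sqrt (p * (1 - p)) ^ 2 = p * (1 - p) := Real.sq_sqrt hpq.le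
  set s := Real.sqrt (p * (1 - p)) with hsdef
  have hr : 0 < 2 * s := by linarith
  have hpi := Real.pi_pos
  refine ⟨fun f => ?_, fun k _ => ?_, fun k => ?_⟩
  · rw [← tendsto_add_atTop_iff_nat 2, integral_arcsine _ hr]
    have hR := riemann (fun t => f (2 * s * Real.cos t)) (by fun_prop)
    have hinv : Tendsto (fun m : ℕ => 1 / ((m:ℝ) + 2)) atTop (𝓝 0) := by
      have := (tendsto_one_div_add_atTop_nhds_zero_nat (𝕜 := ℝ)).comp (tendsto_add_atTop_nat 1)
      refine this.congr fun m => ?_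
      simp only [Function.comp]; push_cast; ring_nf
    have hlim := (hinv.mul_const (f (-1) + f 1 - f (2 * s))).add
      (((hinv.const_sub 1).mul_const (1 / Real.pi)).mul hR)
    simp only [zero_mul, zero_add, sub_zero, one_mul] at hlim
    refine hlim.congr' ?_
    filter_upwards [eventually_ge_atTop 1] with m hm
    rw [integral_emp, sum_lam p s hp hp1 hs hs2 (m+2) (by omega) _ (hlam (m+2)) f, sum_mu]
    push_cast
    have h2 : (m:ℝ) + 2 ≠ 0 := by positivity
    have h1 : (m:ℝ) + 1 ≠ 0 := by positivity
    field_simp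
    ring
  · rw [integral_arcsine _ hr]
    simp_rw [mul_pow (2 * s) _ (2 * k)]
    rw [intervalIntegral.integral_const_mul, int_cos_even, pow_mul, mul_pow, hs2, mul_pow,
      Nat.centralBinom_eq_two_mul_choose]
    norm_num
    field_simp
  · rw [integral_arcsine _ hr]
    simp_rw [mul_pow (2 * s) _ (2 * k + 1)]
    rw [intervalIntegral.integral_const_mul, int_cos_odd]
    simp
end
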